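/- arXiv:2511.10083 — 2 statements merged into one kernel-verified Lean document; each statement's English description precedes it below -/
import Mathlib

section
/- Let p : ℕ → [0,1] be a retention rule, let λ : ℝ^d → [0,∞) be locally integrable, fix x ∈ ℝ^d, an integer K ≥ 0 and R > 0, and set μ_x(r) := ∫_{B(x,r)} λ(y) dy for 0 < r ≤ R. Then for every 0 < r ≤ R, the intensity expansion of the neighbour-count thinning holds in the form |λ(x)·m_p(μ_x(r)) − λ(x)·∑_{k=0}^{K} Δᵏp(0)·μ_x(r)ᵏ/k!| ≤ λ(x) · (2μ_x(r))^{K+1}/(K+1)! · e^{2μ_x(R)}. -/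
open scoped BigOperators
open MeasureTheory

/-- Poisson expectation `m_p(t) = e^{-t} ∑ p(n) tⁿ/n!`. -/
noncomputable def mp (p : ℕ → ℝ) (t : ℝ) : ℝ :=
  Real.exp (-t) * ∑' n : ℕ, p n * t ^ n / (Nat.factorial n : ℝ)

/-- k-th forward finite difference of `p` at 0:  `Δᵏp(0) = ∑_{j=0}^k (-1)^j C(k,j) p(k-j)`. -/
noncomputable def fd (p : ℕ → ℝ) (k : ℕ) : ℝ :=
  ∑ j ∈ Finset.range (k + 1), (-1 : ℝ) ^ j * (Nat.choose k j : ℝ) * p (k - j)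

lemma aux_hasSum_exp (t : ℝ) : HasSum (fun n : ℕ => t ^ n / (Nat.factorial n : ℝ)) (Real.exp t) := by
  rw [Real.exp_eq_exp_ℝ]
  exact NormedSpace.expSeries_div_hasSum_exp t

lemma aux_fd_bound (p : ℕ → ℝ) (hp : ∀ n, 0 ≤ p n ∧ p n ≤ 1) (k : ℕ) : |fd p k| ≤ 2 ^ k := by
  unfold fd
  refine (Finset.abs_sum_le_sum_abs _ _).trans ?_
  have h2 : (2 : ℝ) ^ k = ∑ j ∈ Finset.range (k + 1), (Nat.choose k j : ℝ) := by
    exact_mod_cast (Nat.sum_range_choose k).symm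
  rw [h2]
  refine Finset.sum_le_sum fun j _ => ?_
  rw [abs_mul, abs_mul, abs_pow, abs_neg, abs_one, one_pow, one_mul, Nat.abs_cast,
    abs_of_nonneg (hp _).1]
  exact mul_le_of_le_one_right (Nat.cast_nonneg _) (hp _).2

lemma aux_mp_series (p : ℕ → ℝ) (hp : ∀ n, 0 ≤ p n ∧ p n ≤ 1) (t : ℝ) :
    mp p t = ∑' k : ℕ, fd p k * t ^ k / (Nat.factorial k : ℝ) := by
  unfold mp
  rw [← (aux_hasSum_exp (-t)).tsum_eq, tsum_mul_tsum_eq_tsum_sum_range_of_summable_norm]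
  · refine tsum_congr fun k => ?_
    unfold fd
    rw [Finset.sum_mul, Finset.sum_div]
    refine Finset.sum_congr rfl fun j hj => ?_
    have hj' : j ≤ k := Nat.lt_succ_iff.mp (Finset.mem_range.mp hj)
    rw [Nat.cast_choose ℝ hj', neg_pow t j]
    have ht : t ^ k = t ^ j * t ^ (k - j) := by rw [← pow_add, Nat.add_sub_cancel' hj']
    rw [ht]
    have h1 : (Nat.factorial k : ℝ) ≠ 0 := by positivity
    have h2 : (Nat.factorial j : ℝ) ≠ 0 := by positivity
    have h3 : (Nat.factorial (k - j) : ℝ) ≠ 0 := by positivity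
    field_simp
  · exact (aux_hasSum_exp (-t)).summable.norm
  · refine Summable.of_nonneg_of_le (fun _ => norm_nonneg _) (fun n => ?_)
      (aux_hasSum_exp t).summable.norm
    rw [mul_div_assoc, norm_mul, Real.norm_of_nonneg (hp n).1]
    exact mul_le_of_le_one_left (norm_nonneg _) (hp n).2

lemma aux_bound (p : ℕ → ℝ) (hp : ∀ n, 0 ≤ p n ∧ p n ≤ 1) (t : ℝ) (ht : 0 ≤ t) (K : ℕ) :
    |mp p t - ∑ k ∈ Finset.range (K + 1), fd p k * t ^ k / (Nat.factorial k : ℝ)|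
      ≤ (2 * t) ^ (K + 1) / (Nat.factorial (K + 1) : ℝ) * Real.exp (2 * t) := by
  have hb : ∀ k, ‖fd p k * t ^ k / (Nat.factorial k : ℝ)‖
      ≤ (2 * t) ^ k / (Nat.factorial k : ℝ) := fun k => by
    rw [norm_div, norm_mul, Real.norm_eq_abs, Real.norm_of_nonneg (pow_nonneg ht k),
      Real.norm_of_nonneg (Nat.cast_nonneg _), mul_pow]
    have := aux_fd_bound p hp k
    gcongr
  have hs : Summable fun k => fd p k * t ^ k / (Nat.factorial k : ℝ) :=
    Summable.of_norm_bounded (aux_hasSum_exp (2 * t)).summable hb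
  rw [aux_mp_series p hp, ← hs.sum_add_tsum_nat_add (K + 1), add_sub_cancel_left,
    ← Real.norm_eq_abs]
  refine tsum_of_norm_bounded
    ((aux_hasSum_exp (2 * t)).mul_left ((2 * t) ^ (K + 1) / (Nat.factorial (K + 1) : ℝ)))
    fun i => (hb _).trans ?_
  rw [div_mul_div_comm, ← pow_add, add_comm (K + 1) i]
  have hf : ((Nat.factorial (K + 1) : ℝ) * (Nat.factorial i : ℝ))
      ≤ (Nat.factorial (i + (K + 1)) : ℝ) := by
    rw [mul_comm]
    exact_mod_cast Nat.le_of_dvd (Nat.factorial_pos _)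
      (Nat.factorial_mul_factorial_dvd_factorial_add i (K + 1))
  gcongr

theorem intensity_small_radius_expansion
    {d : ℕ} (p : ℕ → ℝ) (hp : ∀ n, 0 ≤ p n ∧ p n ≤ 1)
    (l : EuclideanSpace ℝ (Fin d) → ℝ) (hl : ∀ y, 0 ≤ l y)
    (hloc : LocallyIntegrable l volume)
    (x : EuclideanSpace ℝ (Fin d)) (K : ℕ) (R : ℝ) (hR : 0 < R)
    (μx : ℝ → ℝ) (hμx : ∀ r : ℝ, μx r = ∫ y in Metric.closedBall x r, l y) :
    ∀ r : ℝ, 0 < r → r ≤ R →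
      |l x * mp p (μx r)
          - l x * ∑ k ∈ Finset.range (K + 1), fd p k * (μx r) ^ k / (Nat.factorial k : ℝ)|
        ≤ l x * ((2 * μx r) ^ (K + 1) / (Nat.factorial (K + 1) : ℝ)) * Real.exp (2 * μx R) := by
  intro r hr hrR
  have hint : IntegrableOn l (Metric.closedBall x R) volume :=
    hloc.integrableOn_isCompact (isCompact_closedBall x R)
  have h0 : 0 ≤ μx r := by
    rw [hμx]
    exact integral_nonneg hl
  have hmono : μx r ≤ μx R := by
    rw [hμx, hμx]
    exact setIntegral_mono_set hint (Filter.Eventually.of_forall hl)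
      (Metric.closedBall_subset_closedBall hrR).eventuallyLE
  rw [← mul_sub, abs_mul, abs_of_nonneg (hl x), mul_assoc]
  refine mul_le_mul_of_nonneg_left ((aux_bound p hp (μx r) h0 K).trans ?_) (hl x)
  gcongr
end

section
/- Moderate-radius integral bound: let d ≥ 1, r > 0, λ > 0, set μ := λ·v_d·r^d, and let p : ℕ → [0,1] satisfy ‖Δp‖∞ := sup_{k ≥ 0} |p(k+1) − p(k)| < ∞ and m_p(μ) > 0. Define g : ℝ^d → ℝ by g(h) := g_p(μ, ω_d(‖h‖/r), 1{‖h‖ ≤ r}). Then ∫_{{h ∈ ℝ^d : ‖h‖ ≤ 2r}} |g(h) − 1| dh ≤ S_{d−1}·r^d · { (μ·‖Δp‖∞²/m_p(μ)²)·J_d + |m₊(μ)²/m_p(μ)² − 1|·(1/d) }, where J_d := ∫_0^2 t^{d−1}·ω_d(t) dt ≤ 2^d/d. -/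
open scoped BigOperators

/-- `Q_p(μ,ω,I) = E[p(U+V₁+I)p(U+V₂+I)]` for independent `U ~ Poisson(μω)`,
`V₁,V₂ ~ Poisson(μ(1-ω))`, written as a triple series. -/
noncomputable def Qp (p : ℕ → ℝ) (μ ω : ℝ) (I : ℕ) : ℝ :=
  Real.exp (-(μ * (2 - ω))) *
    ∑' i : ℕ, ∑' j : ℕ, ∑' k : ℕ,
      p (i + k + I) * p (j + k + I) * (μ * (1 - ω)) ^ (i + j) * (μ * ω) ^ k /
        ((Nat.factorial i : ℝ) * (Nat.factorial j : ℝ) * (Nat.factorial k : ℝ))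

/-- Pair-correlation value `g_p(μ,ω,I) = Q_p(μ,ω,I)/m_p(μ)²`. -/
noncomputable def gp (p : ℕ → ℝ) (μ ω : ℝ) (I : ℕ) : ℝ :=
  Qp p μ ω I / (mp p μ) ^ 2

/-- Shifted Poisson expectation `m₊(t) = E[p(N+1)]` for `N ~ Poisson(t)`. -/
noncomputable def mplus (p : ℕ → ℝ) (t : ℝ) : ℝ :=
  Real.exp (-t) * ∑' n : ℕ, p (n + 1) * t ^ n / (Nat.factorial n : ℝ)

open MeasureTheory

noncomputable def wP (a : ℝ) (n : ℕ) : ℝ := Real.exp (-a) * (a ^ n / (Nat.factorial n : ℝ))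

lemma wP_nonneg {a : ℝ} (ha : 0 ≤ a) (n : ℕ) : 0 ≤ wP a n := by
  unfold wP; positivity

lemma wP_hasSum (a : ℝ) : HasSum (wP a) 1 := by
  have h := (NormedSpace.expSeries_div_hasSum_exp (𝔸 := ℝ) a).mul_left (Real.exp (-a))
  rw [← Real.exp_eq_exp_ℝ, ← Real.exp_add] at h
  rw [neg_add_cancel, Real.exp_zero] at h
  exact h

lemma wP_succ (a : ℝ) (n : ℕ) : ((n + 1 : ℕ) : ℝ) * wP a (n + 1) = a * wP a n := by
  unfold wP
  rw [Nat.factorial_succ]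
  push_cast
  have : (n.factorial : ℝ) ≠ 0 := by positivity
  have : (n + 1 : ℝ) ≠ 0 := by positivity
  field_simp
  ring

lemma wP_hasSum1 (a : ℝ) : HasSum (fun k : ℕ => (k : ℝ) * wP a k) a := by
  have h := (wP_hasSum a).mul_left a
  rw [mul_one] at h
  rw [← hasSum_nat_add_iff' 1]
  simp only [wP_succ]
  simpa using h

lemma wP_hasSum2 (a : ℝ) : HasSum (fun k : ℕ => (k : ℝ) ^ 2 * wP a k) (a ^ 2 + a) := by
  have h := ((wP_hasSum1 a).add (wP_hasSum a)).mul_left a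
  rw [← hasSum_nat_add_iff' 1]
  have e : ∀ n : ℕ, ((n + 1 : ℕ) : ℝ) ^ 2 * wP a (n + 1) = a * (n * wP a n + wP a n) := by
    intro n
    rw [pow_two, mul_assoc, wP_succ]; push_cast; ring
  simp only [e]
  have e2 : a ^ 2 + a - ∑ i ∈ Finset.range 1, (i : ℝ) ^ 2 * wP a i = a * (a + 1) := by
    simp
    ring
  rw [e2]
  exact h

lemma poisson_var {b : ℝ} (hb : 0 ≤ b) (f : ℕ → ℝ) (hf : ∀ n, 0 ≤ f n ∧ f n ≤ 1) (L : ℝ)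
    (hL : ∀ k l : ℕ, (f k - f l) ^ 2 ≤ L ^ 2 * ((k : ℝ) - l) ^ 2) :
    |(∑' k, wP b k * f k ^ 2) - (∑' k, wP b k * f k) ^ 2| ≤ b * L ^ 2 := by
  have s0 := wP_hasSum b
  have s1 := wP_hasSum1 b
  have s2 := wP_hasSum2 b
  have sf : Summable (fun k => wP b k * f k) :=
    Summable.of_nonneg_of_le (fun k => mul_nonneg (wP_nonneg hb k) (hf k).1)
      (fun k => mul_le_of_le_one_right (wP_nonneg hb k) (hf k).2) s0.summable
  have sf2 : Summable (fun k => wP b k * f k ^ 2) :=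
    Summable.of_nonneg_of_le (fun k => mul_nonneg (wP_nonneg hb k) (sq_nonneg _))
      (fun k => mul_le_of_le_one_right (wP_nonneg hb k) (pow_le_one₀ (hf k).1 (hf k).2)) s0.summable
  set F := ∑' k, wP b k * f k with hF
  set G := ∑' k, wP b k * f k ^ 2 with hG
  have hsf : HasSum (fun k => wP b k * f k) F := sf.hasSum
  have hsf2 : HasSum (fun k => wP b k * f k ^ 2) G := sf2.hasSum
  have key : ∀ k : ℕ, f k ^ 2 - 2 * f k * F + G ≤ L ^ 2 * (k ^ 2 - 2 * k * b + (b ^ 2 + b)) := by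
    intro k
    have A := ((s0.mul_left (f k ^ 2)).sub (hsf.mul_left (2 * f k))).add hsf2
    have B := (((s0.mul_left ((k : ℝ) ^ 2)).sub (s1.mul_left (2 * (k : ℝ)))).add s2).mul_left (L ^ 2)
    have := hasSum_le (fun l => ?_) A B
    · linarith
    · have := mul_le_mul_of_nonneg_left (hL k l) (wP_nonneg hb l)
      nlinarith
  have A := (hsf2.sub (hsf.mul_left (2 * F))).add (s0.mul_left G)
  have B := ((s2.sub (s1.mul_left (2 * b))).add (s0.mul_left (b ^ 2 + b))).mul_left (L ^ 2)
  have h1 := hasSum_le (fun k => ?_) A B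
  · have h2 : 0 ≤ G - F ^ 2 := by
      have C := (hsf2.sub (hsf.mul_left (2 * F))).add (s0.mul_left (F ^ 2))
      have := C.nonneg (fun k => ?_)
      · nlinarith
      · have := mul_nonneg (wP_nonneg hb k) (sq_nonneg (f k - F))
        nlinarith
    rw [abs_of_nonneg h2]
    nlinarith
  · have := mul_le_mul_of_nonneg_left (key k) (wP_nonneg hb k)
    nlinarith

lemma summable_pair {a b : ℝ} (ha : 0 ≤ a) (hb : 0 ≤ b) (c : ℕ → ℕ → ℝ)
    (hc : ∀ i k, 0 ≤ c i k ∧ c i k ≤ 1) :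
    Summable (fun x : ℕ × ℕ => wP a x.1 * wP b x.2 * c x.1 x.2) := by
  have h := (wP_hasSum a).summable.mul_of_nonneg (wP_hasSum b).summable (wP_nonneg ha) (wP_nonneg hb)
  refine Summable.of_nonneg_of_le (fun x => ?_) (fun x => ?_) h
  · exact mul_nonneg (mul_nonneg (wP_nonneg ha _) (wP_nonneg hb _)) (hc _ _).1
  · exact mul_le_of_le_one_right (mul_nonneg (wP_nonneg ha _) (wP_nonneg hb _)) (hc _ _).2

noncomputable def fP (q : ℕ → ℝ) (a : ℝ) (k : ℕ) : ℝ := ∑' i, wP a i * q (i + k)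

lemma fP_summable {a : ℝ} (ha : 0 ≤ a) (q : ℕ → ℝ) (hq : ∀ n, 0 ≤ q n ∧ q n ≤ 1) (k : ℕ) :
    Summable (fun i => wP a i * q (i + k)) :=
  Summable.of_nonneg_of_le (fun i => mul_nonneg (wP_nonneg ha i) (hq _).1)
      (fun i => mul_le_of_le_one_right (wP_nonneg ha i) (hq _).2) (wP_hasSum a).summable

lemma fP_mem {a : ℝ} (ha : 0 ≤ a) (q : ℕ → ℝ) (hq : ∀ n, 0 ≤ q n ∧ q n ≤ 1) (k : ℕ) :
    0 ≤ fP q a k ∧ fP q a k ≤ 1 := by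
  constructor
  · exact tsum_nonneg (fun i => mul_nonneg (wP_nonneg ha i) (hq _).1)
  · exact hasSum_le (fun i => mul_le_of_le_one_right (wP_nonneg ha i) (hq _).2)
      (fP_summable ha q hq k).hasSum (wP_hasSum a)

lemma fP_lip {a : ℝ} (ha : 0 ≤ a) (q : ℕ → ℝ) (hq : ∀ n, 0 ≤ q n ∧ q n ≤ 1) (L : ℝ)
    (hL : ∀ n, |q (n + 1) - q n| ≤ L) (k l : ℕ) :
    (fP q a k - fP q a l) ^ 2 ≤ L ^ 2 * ((k : ℝ) - l) ^ 2 := by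
  have step : ∀ n m, |q (n + m) - q n| ≤ L * m := by
    intro n m
    induction m with
    | zero => simp
    | succ m ih =>
      have := abs_sub_le (q (n + (m + 1))) (q (n + m)) (q n)
      have h2 := hL (n + m)
      push_cast
      rw [add_assoc] at h2
      linarith
  have main : ∀ k m, |fP q a (k + m) - fP q a k| ≤ L * m := by
    intro k m
    have A := (fP_summable ha q hq (k + m)).hasSum.sub (fP_summable ha q hq k).hasSum
    have B := (wP_hasSum a).mul_right (L * m)
    rw [one_mul] at B
    have e : ∀ i, wP a i * q (i + (k + m)) - wP a i * q (i + k) ≤ wP a i * (L * m) ∧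
        -(wP a i * (L * m)) ≤ wP a i * q (i + (k + m)) - wP a i * q (i + k) := by
      intro i
      have h := abs_le.1 (step (i + k) m)
      rw [add_assoc] at h
      have h1 := mul_le_mul_of_nonneg_left h.1 (wP_nonneg ha i)
      have h2 := mul_le_mul_of_nonneg_left h.2 (wP_nonneg ha i)
      constructor <;> nlinarith
    rw [abs_le]
    exact ⟨hasSum_le (fun i => (e i).2) B.neg A, hasSum_le (fun i => (e i).1) A B⟩
  have fin : ∀ k m, (fP q a (k + m) - fP q a k) ^ 2 ≤ L ^ 2 * (m : ℝ) ^ 2 := by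
    intro k m
    have := main k m
    rw [← mul_pow, ← sq_abs]
    exact pow_le_pow_left₀ (abs_nonneg _) this 2
  rcases le_total k l with h | h
  · obtain ⟨m, rfl⟩ := Nat.exists_eq_add_of_le h
    have := fin k m
    push_cast
    nlinarith
  · obtain ⟨m, rfl⟩ := Nat.exists_eq_add_of_le h
    have := fin l m
    push_cast
    nlinarith

lemma wP_conv (a b : ℝ) (n : ℕ) :
    ∑ x ∈ Finset.HasAntidiagonal.antidiagonal n, wP a x.1 * wP b x.2 = wP (a + b) n := by
  have e : wP (a + b) n = Real.exp (-(a + b)) * ((a + b) ^ n / (n.factorial : ℝ)) := rfl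
  rw [e, (Commute.all a b).add_pow', Finset.sum_div, Finset.mul_sum]
  refine Finset.sum_congr rfl fun x hx => ?_
  rw [Finset.HasAntidiagonal.mem_antidiagonal] at hx
  subst hx
  have h := Nat.add_choose_mul_factorial_mul_factorial x.1 x.2
  have h' : ((x.1 + x.2).choose x.1 : ℝ) * x.1.factorial * x.2.factorial = (x.1 + x.2).factorial := by
    rw [Nat.choose_symm_add]
    exact_mod_cast h
  rw [neg_add, Real.exp_add, ← h', nsmul_eq_mul]
  have h3 : ((x.1 + x.2).choose x.1 : ℝ) ≠ 0 := by
    exact_mod_cast (Nat.choose_pos (Nat.le_add_right _ _)).ne'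
  unfold wP
  field_simp

lemma fP_mean {a b : ℝ} (ha : 0 ≤ a) (hb : 0 ≤ b) (q : ℕ → ℝ) (hq : ∀ n, 0 ≤ q n ∧ q n ≤ 1) :
    ∑' k, wP b k * fP q a k = ∑' n, wP (a + b) n * q n := by
  have s := summable_pair hb ha (fun k i => q (i + k)) (fun _ _ => hq _)
  have s' := (Finset.HasAntidiagonal.sigmaAntidiagonalEquivProd (A := ℕ)).summable_iff.2 s
  have e1 : ∑' k, wP b k * fP q a k = ∑' x : ℕ × ℕ, wP b x.1 * wP a x.2 * q (x.2 + x.1) := by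
    rw [s.tsum_prod]
    refine tsum_congr fun k => ?_
    rw [fP, ← tsum_mul_left]
    exact tsum_congr fun i => by ring
  rw [e1, ← (Finset.HasAntidiagonal.sigmaAntidiagonalEquivProd (A := ℕ)).tsum_eq]
  refine s'.tsum_sigma.trans ?_
  refine tsum_congr fun n => ?_
  rw [tsum_fintype, add_comm a b, ← wP_conv, Finset.sum_mul, 
    ← Finset.sum_coe_sort (Finset.HasAntidiagonal.antidiagonal n) (fun x => wP b x.1 * wP a x.2 * q n)]
  refine Finset.sum_congr rfl fun x _ => ?_
  have := Finset.HasAntidiagonal.mem_antidiagonal.1 x.2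
  simp only [Function.comp, Finset.HasAntidiagonal.sigmaAntidiagonalEquivProd_apply]
  rw [add_comm x.1.2, this]

lemma Qp_eq (p : ℕ → ℝ) (hp : ∀ n, 0 ≤ p n ∧ p n ≤ 1) (μ ω : ℝ) (I : ℕ)
    (ha : 0 ≤ μ * (1 - ω)) (hb : 0 ≤ μ * ω) :
    Qp p μ ω I = ∑' k, wP (μ * ω) k * fP (fun n => p (n + I)) (μ * (1 - ω)) k ^ 2 := by
  set a := μ * (1 - ω) with hadef
  set b := μ * ω with hbdef
  set q : ℕ → ℝ := fun n => p (n + I) with hqdef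
  have hq : ∀ n, 0 ≤ q n ∧ q n ≤ 1 := fun n => hp _
  have hf := fP_mem ha q hq
  have e0 : Qp p μ ω I = ∑' i, ∑' j, ∑' k, wP a i * (wP a j * wP b k * (q (i + k) * q (j + k))) := by
    rw [Qp, ← hadef, ← hbdef, ← tsum_mul_left]
    refine tsum_congr fun i => ?_
    rw [← tsum_mul_left]
    refine tsum_congr fun j => ?_
    rw [← tsum_mul_left]
    refine tsum_congr fun k => ?_
    have : -(μ * (2 - ω)) = -a + -a + -b := by rw [hadef, hbdef]; ring
    rw [this, Real.exp_add, Real.exp_add, pow_add]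
    simp only [wP, hqdef]
    field_simp
  have e1 : ∀ i, ∑' j, ∑' k, wP a i * (wP a j * wP b k * (q (i + k) * q (j + k)))
      = ∑' k, wP a i * wP b k * (q (i + k) * fP q a k) := by
    intro i
    have s := (summable_pair ha hb (fun j k => q (i + k) * q (j + k))
      (fun j k => ⟨mul_nonneg (hq _).1 (hq _).1, mul_le_one₀ (hq _).2 (hq _).1 (hq _).2⟩)).mul_left (wP a i)
    rw [← Summable.tsum_comm (f := fun j k => wP a i * (wP a j * wP b k * (q (i + k) * q (j + k)))) s]
    refine tsum_congr fun k => ?_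
    rw [fP, ← mul_assoc, ← tsum_mul_left]
    exact tsum_congr fun j => by ring
  rw [e0]
  simp only [e1]
  have s := summable_pair ha hb (fun i k => q (i + k) * fP q a k)
      (fun i k => ⟨mul_nonneg (hq _).1 (hf _).1, mul_le_one₀ (hq _).2 (hf _).1 (hf _).2⟩)
  rw [← Summable.tsum_comm (f := fun i k => wP a i * wP b k * (q (i + k) * fP q a k)) s]
  refine tsum_congr fun k => ?_
  have : wP b k * fP q a k ^ 2 = (wP b k * fP q a k) * fP q a k := by ring
  rw [this]
  conv_rhs => rw [fP.eq_def q a k]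
  rw [← tsum_mul_left]
  refine tsum_congr fun i => ?_
  rw [← fP.eq_def q a k]
  ring

lemma Qp_bound (p : ℕ → ℝ) (hp : ∀ n, 0 ≤ p n ∧ p n ≤ 1) (μ ω L : ℝ) (I : ℕ)
    (hμ : 0 ≤ μ) (h0 : 0 ≤ ω) (h1 : ω ≤ 1) (hL : ∀ k, |p (k + 1) - p k| ≤ L) :
    |Qp p μ ω I - (∑' n, wP μ n * p (n + I)) ^ 2| ≤ μ * ω * L ^ 2 := by
  have ha : 0 ≤ μ * (1 - ω) := mul_nonneg hμ (by linarith)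
  have hb : 0 ≤ μ * ω := mul_nonneg hμ h0
  have hq : ∀ n, 0 ≤ p (n + I) ∧ p (n + I) ≤ 1 := fun n => hp _
  rw [Qp_eq p hp μ ω I ha hb]
  have hm := fP_mean ha hb (fun n => p (n + I)) hq
  have : μ * (1 - ω) + μ * ω = μ := by ring
  rw [this] at hm
  rw [← hm]
  refine poisson_var hb _ (fP_mem ha _ hq) L (fP_lip ha _ hq L fun n => ?_)
  have := hL (n + I)
  rwa [add_right_comm]

lemma mp_eq (p : ℕ → ℝ) (μ : ℝ) : mp p μ = ∑' n, wP μ n * p (n + 0) := by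
  rw [mp, ← tsum_mul_left]
  exact tsum_congr fun n => by simp only [wP, add_zero]; ring

lemma mplus_eq (p : ℕ → ℝ) (μ : ℝ) : mplus p μ = ∑' n, wP μ n * p (n + 1) := by
  rw [mplus, ← tsum_mul_left]
  exact tsum_congr fun n => by simp only [wP]; ring

theorem moderate_radius_integral_bound
    (d : ℕ) (hd : 0 < d) (r lam : ℝ) (hr : 0 < r) (hlam : 0 < lam)
    (p : ℕ → ℝ) (hp : ∀ n, 0 ≤ p n ∧ p n ≤ 1)
    (L : ℝ) (hL : L = ⨆ k : ℕ, |p (k + 1) - p k|)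
    (vd : ℝ)
    (hvd : vd = (volume (Metric.closedBall (0 : EuclideanSpace ℝ (Fin d)) 1)).toReal)
    (μ : ℝ) (hμ : μ = lam * vd * r ^ d) (hm : 0 < mp p μ)
    (ωd : ℝ → ℝ)
    (hωd : ∀ t : ℝ, ωd t =
      (volume (Metric.closedBall (0 : EuclideanSpace ℝ (Fin d)) 1 ∩
        Metric.closedBall (t • EuclideanSpace.single (⟨0, hd⟩ : Fin d) (1 : ℝ)) 1)).toReal / vd)
    (g : EuclideanSpace ℝ (Fin d) → ℝ)
    (hg : ∀ h, g h = gp p μ (ωd (‖h‖ / r)) (if ‖h‖ ≤ r then 1 else 0))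
    (J : ℝ) (hJ : J = ∫ t in (0 : ℝ)..2, t ^ (d - 1) * ωd t) :
    J ≤ 2 ^ d / (d : ℝ) ∧
    (∫ h in Metric.closedBall (0 : EuclideanSpace ℝ (Fin d)) (2 * r), |g h - 1|)
      ≤ (d : ℝ) * vd * r ^ d *
          ((μ * L ^ 2 / (mp p μ) ^ 2) * J
            + |(mplus p μ) ^ 2 / (mp p μ) ^ 2 - 1| * (1 / (d : ℝ))) := by
  classical
  have : Nonempty (Fin d) := ⟨⟨0, hd⟩⟩
  have : Nontrivial (EuclideanSpace ℝ (Fin d)) := inferInstance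
  have hvd0 : 0 ≤ vd := by rw [hvd]; exact ENNReal.toReal_nonneg
  have hμ0 : 0 ≤ μ := by rw [hμ]; positivity
  have hω0 : ∀ t, 0 ≤ ωd t := fun t => by rw [hωd]; positivity
  have hω1 : ∀ t, ωd t ≤ 1 := fun t => by
    rw [hωd]
    refine div_le_one_of_le₀ ?_ hvd0
    rw [hvd]
    exact ENNReal.toReal_mono (measure_closedBall_lt_top).ne (measure_mono Set.inter_subset_left)
  have hωm : Measurable ωd := by
    have e : ωd = fun t => (volume (Prod.mk t ⁻¹' {x : ℝ × EuclideanSpace ℝ (Fin d) |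
        dist x.2 0 ≤ 1 ∧ dist x.2 (x.1 • EuclideanSpace.single (⟨0, hd⟩ : Fin d) (1 : ℝ)) ≤ 1})).toReal / vd := by
      funext t
      rw [hωd]
      rfl
    rw [e]
    refine Measurable.div_const (Measurable.ennreal_toReal (measurable_measure_prodMk_left ?_)) _
    refine MeasurableSet.inter (s₁ := {x : ℝ × EuclideanSpace ℝ (Fin d) | dist x.2 0 ≤ 1})
      (s₂ := {x : ℝ × EuclideanSpace ℝ (Fin d) |
        dist x.2 (x.1 • EuclideanSpace.single (⟨0, hd⟩ : Fin d) (1 : ℝ)) ≤ 1}) ?_ ?_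
    · exact (isClosed_le (by fun_prop) continuous_const).measurableSet
    · exact (isClosed_le (by fun_prop) continuous_const).measurableSet
  have hLk : ∀ k, |p (k + 1) - p k| ≤ L := by
    intro k
    rw [hL]
    refine le_ciSup (f := fun k => |p (k + 1) - p k|) ⟨1, ?_⟩ k
    rintro _ ⟨k, rfl⟩
    have h1 := hp k
    have h2 := hp (k + 1)
    simp only
    rw [abs_le]
    constructor <;> linarith
  have hd' : (d : ℝ) ≠ 0 := by positivity
  constructor
  · have e : (∫ t in (0 : ℝ)..2, t ^ (d - 1)) = 2 ^ d / (d : ℝ) := by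
      rw [integral_pow]
      obtain ⟨n, rfl⟩ := Nat.exists_eq_succ_of_ne_zero hd.ne'
      simp
    have hi : IntervalIntegrable (fun t : ℝ => t ^ (d - 1)) volume 0 2 :=
      (continuous_pow _).intervalIntegrable _ _
    rw [hJ, ← e]
    refine intervalIntegral.integral_mono_on (by norm_num) ?_ hi ?_
    · refine hi.mono_fun (by fun_prop) (Filter.Eventually.of_forall fun t => ?_)
      simp only [norm_mul]
      refine mul_le_of_le_one_right (norm_nonneg _) ?_
      rw [Real.norm_of_nonneg (hω0 t)]
      exact hω1 t
    · intro t ht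
      exact mul_le_of_le_one_right (pow_nonneg ht.1 _) (hω1 t)
  have hfin : Module.finrank ℝ (EuclideanSpace ℝ (Fin d)) = d := by simp
  have hball : volume.real (Metric.ball (0 : EuclideanSpace ℝ (Fin d)) 1) = vd := by
    rw [hvd, ← Measure.addHaar_real_closedBall_eq_addHaar_real_ball]
    rfl
  set A := μ * L ^ 2 / (mp p μ) ^ 2 with hA
  set B := |(mplus p μ) ^ 2 / (mp p μ) ^ 2 - 1| with hB
  have hm2 : 0 < (mp p μ) ^ 2 := by positivity
  have pt : ∀ h, |g h - 1| ≤ A * ωd (‖h‖ / r) + (Metric.closedBall (0 : EuclideanSpace ℝ (Fin d)) r).indicator (fun _ => B) h := by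
    intro h
    have gen : ∀ I : ℕ, ∀ M : ℝ, M = ∑' n, wP μ n * p (n + I) →
        |gp p μ (ωd (‖h‖ / r)) I - 1| ≤ A * ωd (‖h‖ / r) + |M ^ 2 / (mp p μ) ^ 2 - 1| := by
      intro I M hM
      have hb := Qp_bound p hp μ (ωd (‖h‖ / r)) L I hμ0 (hω0 _) (hω1 _) hLk
      rw [← hM] at hb
      have e : gp p μ (ωd (‖h‖ / r)) I - 1
          = (Qp p μ (ωd (‖h‖ / r)) I - M ^ 2) / (mp p μ) ^ 2 + (M ^ 2 / (mp p μ) ^ 2 - 1) := by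
        rw [gp]; ring
      rw [e]
      refine (abs_add_le _ _).trans (add_le_add_left ?_ _)
      rw [abs_div, abs_of_pos hm2, hA, div_mul_eq_mul_div]
      refine div_le_div_of_nonneg_right ?_ hm2.le
      linarith
    rw [hg]
    by_cases hh : ‖h‖ ≤ r
    · rw [if_pos hh, Set.indicator_of_mem (by simpa using hh)]
      exact gen 1 _ (mplus_eq p μ)
    · rw [if_neg hh, Set.indicator_of_notMem (by simpa using hh)]
      have := gen 0 _ (mp_eq p μ)
      rwa [div_self hm2.ne', sub_self, abs_zero] at this
  have i1 : IntegrableOn (fun h : EuclideanSpace ℝ (Fin d) => ωd (‖h‖ / r))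
      (Metric.closedBall 0 (2 * r)) := by
    refine Measure.integrableOn_of_bounded (M := 1) (measure_closedBall_lt_top).ne ?_ ?_
    · exact (hωm.comp (measurable_norm.div_const r)).aestronglyMeasurable
    · refine Filter.Eventually.of_forall fun h => ?_
      rw [Real.norm_of_nonneg (hω0 _)]
      exact hω1 _
  have i2 : IntegrableOn ((Metric.closedBall (0 : EuclideanSpace ℝ (Fin d)) r).indicator (fun _ => B))
      (Metric.closedBall 0 (2 * r)) := by
    refine Integrable.indicator ?_ Metric.isClosed_closedBall.measurableSet
    exact integrableOn_const (measure_closedBall_lt_top).ne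
  have up : (∫ h in Metric.closedBall (0 : EuclideanSpace ℝ (Fin d)) (2 * r), |g h - 1|) ≤
      ∫ h in Metric.closedBall (0 : EuclideanSpace ℝ (Fin d)) (2 * r), (A * ωd (‖h‖ / r) +
        (Metric.closedBall (0 : EuclideanSpace ℝ (Fin d)) r).indicator (fun _ => B) h) :=
    integral_mono_of_nonneg (Filter.Eventually.of_forall fun h => abs_nonneg _)
      ((i1.const_mul A).add i2) (Filter.Eventually.of_forall pt)
  have c1 : ∫ h in Metric.closedBall (0 : EuclideanSpace ℝ (Fin d)) (2 * r), ωd (‖h‖ / r)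
      = d * vd * r ^ d * J := by
    have e1 : ∫ h in Metric.closedBall (0 : EuclideanSpace ℝ (Fin d)) (2 * r), ωd (‖h‖ / r)
        = ∫ h : EuclideanSpace ℝ (Fin d), (fun s : ℝ => (Set.Iic (2 * r)).indicator (fun s => ωd (s / r)) s) ‖h‖ := by
      rw [← integral_indicator Metric.isClosed_closedBall.measurableSet]
      refine integral_congr_ae (Filter.Eventually.of_forall fun h => ?_)
      simp only [Set.indicator_apply, mem_closedBall_zero_iff, Set.mem_Iic]
    have e2 : ∫ y in Set.Ioi (0 : ℝ), y ^ (d - 1) • (Set.Iic (2 * r)).indicator (fun s => ωd (s / r)) y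
        = ∫ y in (0 : ℝ)..(2 * r), y ^ (d - 1) * ωd (y / r) := by
      rw [intervalIntegral.integral_of_le (by positivity), ← Set.Ioi_inter_Iic,
        ← Set.indicator_smul, setIntegral_indicator measurableSet_Iic]
      rfl
    have e3 : ∫ y in (0 : ℝ)..(2 * r), y ^ (d - 1) * ωd (y / r) = r ^ d * J := by
      have := intervalIntegral.integral_comp_div (a := 0) (b := 2 * r)
        (fun t => (t ^ (d - 1) * ωd t)) hr.ne'
      rw [zero_div, mul_div_cancel_right₀ _ hr.ne', ← hJ, smul_eq_mul] at this
      have e4 : r ^ d = r ^ (d - 1) * r := by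
        rw [← pow_succ, Nat.sub_add_cancel hd]
      rw [e4, mul_assoc, ← this, ← intervalIntegral.integral_const_mul]
      congr 1
      funext y
      rw [div_pow]
      field_simp
    rw [e1, integral_fun_norm_addHaar, hfin, hball, e2, e3]
    simp only [nsmul_eq_mul, smul_eq_mul]
    ring
  have c2 : ∫ h in Metric.closedBall (0 : EuclideanSpace ℝ (Fin d)) (2 * r),
      (Metric.closedBall (0 : EuclideanSpace ℝ (Fin d)) r).indicator (fun _ => B) h = vd * r ^ d * B := by
    rw [setIntegral_indicator Metric.isClosed_closedBall.measurableSet,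
      Set.inter_eq_right.2 (Metric.closedBall_subset_closedBall (by linarith)),
      setIntegral_const, Measure.addHaar_real_closedBall _ _ hr.le, hfin, hball, smul_eq_mul]
    ring
  refine up.trans (le_of_eq ?_)
  rw [integral_add (i1.const_mul A) i2, integral_const_mul, c1, c2]
  field_simp
end
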